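/- arXiv:1105.5945 — 2 statements merged into one kernel-verified Lean document; each statement's English description precedes it below -/
import Mathlib

section
/- Let 𝒲^𝒢 = {(1,0), (−1,0), (1/2, √3/2), (−1/2, √3/2)} ⊂ ℝ². Let α > 0, let r satisfy 0 < r ≤ α, and let ρ satisfy 0 < ρ ≤ r/2. Then for every y ∈ 𝒢_r there exists u ∈ 𝒲^𝒢 such that y ∈ C_{u,r} ⊆ B(y,r) and μ(C_{u,r} ∩ B((α−ρ)e₂, α)) ≥ (π/12)·r^{1/2}·ρ^{3/2}. -/
open MeasureTheory Metric Set
open scoped RealInnerProductSpace ENNReal Real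

noncomputable section

/-- The Euclidean plane. -/
abbrev E2 := EuclideanSpace ℝ (Fin 2)

/-- The point `(a, b)` of the Euclidean plane. -/
def pt (a b : ℝ) : E2 := (WithLp.equiv 2 (Fin 2 → ℝ)).symm ![a, b]

/-- The cone `C_u^θ = {x : ⟪x, u⟫ ≥ ‖x‖ cos θ}`. -/
def cone (u : E2) (θ : ℝ) : Set E2 := {x | ‖x‖ * Real.cos θ ≤ ⟪x, u⟫}

/-- The circular sector `C_{u,r}^θ = C_u^θ ∩ B(0, r)`. -/
def sector (u : E2) (θ r : ℝ) : Set E2 := cone u θ ∩ closedBall (0 : E2) r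

/-- The unit vector `e₂ = (0, 1)`. -/
def e₂ : E2 := pt 0 1

/-- `𝒢_r = {y ∈ B(0,r) : ⟪y, e₂⟫ ≥ −‖y‖/2}`. -/
def Gset (r : ℝ) : Set E2 := {y ∈ closedBall (0 : E2) r | -(‖y‖ / 2) ≤ ⟪y, e₂⟫}

/-- The four unit vectors of `𝒲^𝒢`. -/
def W𝒢 : Set E2 :=
  {pt 1 0, pt (-1) 0, pt (1 / 2) (Real.sqrt 3 / 2), pt (-(1 / 2)) (Real.sqrt 3 / 2)}

lemma le_of_sq_le_sq_aux {a b : ℝ} (h : a ^ 2 ≤ b ^ 2) (hb : 0 ≤ b) : a ≤ b :=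
  (le_abs_self a).trans (abs_le_of_sq_le_sq h hb)

lemma pt_zero' (a b : ℝ) : pt a b 0 = a := by simp [pt]
lemma pt_one' (a b : ℝ) : pt a b 1 = b := by simp [pt]

lemma norm_sq_E2 (x : E2) : ‖x‖ ^ 2 = x 0 ^ 2 + x 1 ^ 2 := by
  rw [EuclideanSpace.norm_sq_eq]; simp [Fin.sum_univ_two]

lemma inner_E2 (x y : E2) : ⟪x, y⟫ = x 0 * y 0 + x 1 * y 1 := by
  simp [PiLp.inner_apply, Fin.sum_univ_two, mul_comm]

/-- The reflection with matrix `(a, b; b, -a)`. -/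
def reflMap (a b : ℝ) : E2 →ₗ[ℝ] E2 where
  toFun x := pt (a * x 0 + b * x 1) (b * x 0 - a * x 1)
  map_add' x y := by
    ext i; fin_cases i <;> simp [pt] <;> ring
  map_smul' c x := by
    ext i; fin_cases i <;> simp [pt] <;> ring

lemma reflMap_apply (a b : ℝ) (x : E2) :
    reflMap a b x = pt (a * x 0 + b * x 1) (b * x 0 - a * x 1) := rfl

lemma vol_refl (a b : ℝ) (h : a ^ 2 + b ^ 2 = 1) (S : Set E2) (hS : MeasurableSet S) :
    volume ((reflMap a b) ⁻¹' S) = volume S := by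
  have hn : ∀ x, ‖reflMap a b x‖ = ‖x‖ := by
    intro x
    have : ‖reflMap a b x‖ ^ 2 = ‖x‖ ^ 2 := by
      rw [norm_sq_E2, norm_sq_E2, reflMap_apply, pt_zero', pt_one']
      linear_combination (x 0 ^ 2 + x 1 ^ 2) * h
    exact (sq_eq_sq₀ (norm_nonneg _) (norm_nonneg _)).1 this
  let L : E2 →ₗᵢ[ℝ] E2 := ⟨reflMap a b, hn⟩
  let L' : E2 ≃ₗᵢ[ℝ] E2 := L.toLinearIsometryEquiv rfl
  have hp := L'.measurePreserving.measure_preimage hS.nullMeasurableSet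
  exact hp

/-- Sector of angles `0..30` degrees. -/
def TT (R : ℝ) : Set E2 := {x | 0 ≤ x 1 ∧ √3 * x 1 ≤ x 0 ∧ x 0 ^ 2 + x 1 ^ 2 ≤ R}
def QQ (R : ℝ) : Set E2 := {x | 0 ≤ x 1 ∧ 0 ≤ x 0 ∧ x 0 ^ 2 + x 1 ^ 2 ≤ R}
def UU (R : ℝ) : Set E2 := {x | 0 ≤ x 1 ∧ x 0 ^ 2 + x 1 ^ 2 ≤ R}

lemma measTT (R : ℝ) : MeasurableSet (TT R) := by
  have h1 : IsClosed {x : E2 | 0 ≤ x 1} := isClosed_le (by fun_prop) (by fun_prop)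
  have h2 : IsClosed {x : E2 | √3 * x 1 ≤ x 0} := isClosed_le (by fun_prop) (by fun_prop)
  have h3 : IsClosed {x : E2 | x 0 ^ 2 + x 1 ^ 2 ≤ R} := isClosed_le (by fun_prop) (by fun_prop)
  exact (h1.inter (h2.inter h3)).measurableSet
lemma measQQ (R : ℝ) : MeasurableSet (QQ R) := by
  have h1 : IsClosed {x : E2 | 0 ≤ x 1} := isClosed_le (by fun_prop) (by fun_prop)
  have h2 : IsClosed {x : E2 | 0 ≤ x 0} := isClosed_le (by fun_prop) (by fun_prop)
  have h3 : IsClosed {x : E2 | x 0 ^ 2 + x 1 ^ 2 ≤ R} := isClosed_le (by fun_prop) (by fun_prop)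
  exact (h1.inter (h2.inter h3)).measurableSet
lemma measUU (R : ℝ) : MeasurableSet (UU R) := by
  have h1 : IsClosed {x : E2 | 0 ≤ x 1} := isClosed_le (by fun_prop) (by fun_prop)
  have h3 : IsClosed {x : E2 | x 0 ^ 2 + x 1 ^ 2 ≤ R} := isClosed_le (by fun_prop) (by fun_prop)
  exact (h1.inter h3).measurableSet

lemma s3 : √3 ^ 2 = (3 : ℝ) := Real.sq_sqrt (by norm_num)
lemma s3p : 0 < √(3 : ℝ) := by positivity

lemma vol_TT (R : ℝ) (hR : 0 ≤ R) : ENNReal.ofReal (π / 12 * R) ≤ volume (TT R) := by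
  have hb : volume (ball (0 : E2) (√R)) ≤ volume (UU R) + volume (UU R) := by
    conv_rhs => rw [← vol_refl 1 0 (by norm_num) _ (measUU R)]; arg 2; rw [vol_refl 1 0 (by norm_num) _ (measUU R)]
    refine le_trans (measure_mono ?_) (measure_union_le _ _)
    intro x hx
    have h1 : ‖x‖ ^ 2 ≤ R := by
      rw [mem_ball_zero_iff] at hx
      calc ‖x‖ ^ 2 ≤ √R ^ 2 := by gcongr
        _ = R := Real.sq_sqrt hR
    rw [norm_sq_E2] at h1
    simp only [mem_union, mem_preimage, UU, mem_ofPred_eq, reflMap_apply, pt_zero', pt_one']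
    rcases le_total 0 (x 1) with h | h
    · right; exact ⟨h, h1⟩
    · left; constructor <;> nlinarith
  have hu : volume (UU R) ≤ volume (QQ R) + volume (QQ R) := by
    conv_rhs => rw [← vol_refl (-1) 0 (by norm_num) _ (measQQ R)]; arg 2; rw [vol_refl (-1) 0 (by norm_num) _ (measQQ R)]
    refine le_trans (measure_mono ?_) (measure_union_le _ _)
    rintro x ⟨hx, h1⟩
    simp only [mem_union, mem_preimage, QQ, mem_ofPred_eq, reflMap_apply, pt_zero', pt_one']
    rcases le_total 0 (x 0) with h | h
    · right; exact ⟨hx, h, h1⟩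
    · left; refine ⟨?_, ?_, ?_⟩ <;> nlinarith
  have hq : volume (QQ R) ≤ volume (TT R) + volume (TT R) + volume (TT R) := by
    calc volume (QQ R) ≤ volume (TT R ∪ reflMap 0 1 ⁻¹' TT R ∪ reflMap (1/2) (√3/2) ⁻¹' TT R) := by
          apply measure_mono
          rintro x ⟨hx, hx0, h1⟩
          simp only [mem_union, mem_preimage, TT, mem_ofPred_eq, reflMap_apply, pt_zero', pt_one']
          have := s3
          have := s3p
          by_cases ha : √3 * x 1 ≤ x 0
          · left; left; exact ⟨hx, ha, h1⟩
          by_cases hb : √3 * x 0 ≤ x 1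
          · left; right; refine ⟨?_, ?_, ?_⟩ <;> nlinarith
          right
          refine ⟨?_, ?_, ?_⟩
          · nlinarith
          · nlinarith
          · refine le_trans (le_of_eq ?_) h1
            linear_combination (x 0 ^ 2 + x 1 ^ 2) / 4 * s3
      _ ≤ _ := by
          refine le_trans (measure_union_le _ _) ?_
          rw [vol_refl _ _ (by nlinarith [s3]) _ (measTT R)]
          gcongr
          refine le_trans (measure_union_le _ _) ?_
          rw [vol_refl _ _ (by norm_num) _ (measTT R)]
  rw [EuclideanSpace.volume_ball_fin_two] at hb
  have e : ENNReal.ofReal √R ^ 2 * ENNReal.ofReal π = 12 * ENNReal.ofReal (π / 12 * R) := by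
    rw [← ENNReal.ofReal_pow (by positivity), Real.sq_sqrt hR,
      show (12 : ℝ≥0∞) = ENNReal.ofReal 12 by simp, ← ENNReal.ofReal_mul hR,
      ← ENNReal.ofReal_mul (by norm_num)]
    congr 1; ring
  have hfin : 12 * ENNReal.ofReal (π / 12 * R) ≤ 12 * volume (TT R) := by
    rw [← e]
    refine hb.trans ((add_le_add hu hu).trans ((add_le_add (add_le_add hq hq) (add_le_add hq hq)).trans (le_of_eq ?_)))
    ring
  exact (ENNReal.mul_le_mul_iff_right (by norm_num) (by norm_num)).1 hfin

lemma mem_cone_of (u x : E2) (h0 : 0 ≤ ⟪x, u⟫) (h : 3 / 4 * (x 0 ^ 2 + x 1 ^ 2) ≤ ⟪x, u⟫ ^ 2) :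
    x ∈ cone u (π / 6) := by
  simp only [cone, mem_ofPred_eq, Real.cos_pi_div_six]
  refine le_of_sq_le_sq_aux ?_ h0
  rw [mul_pow, norm_sq_E2, div_pow, s3]
  linarith

lemma sector_diam (u y : E2) (r : ℝ) (hu : u 0 ^ 2 + u 1 ^ 2 = 1) (hy : y ∈ sector u (π / 6) r) :
    sector u (π / 6) r ⊆ closedBall y r := by
  rintro z ⟨hz, hzr⟩
  obtain ⟨hy, hyr⟩ := hy
  rw [mem_closedBall_zero_iff] at hzr hyr
  simp only [cone, mem_ofPred_eq, Real.cos_pi_div_six] at hz hy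
  have key : ∀ w : E2, ‖w‖ * (√3 / 2) ≤ ⟪w, u⟫ → |w 0 * u 1 - w 1 * u 0| ≤ ‖w‖ / 2 := by
    intro w hw
    apply abs_le_of_sq_le_sq _ (by positivity)
    have h1 : (‖w‖ * (√3 / 2)) ^ 2 ≤ ⟪w, u⟫ ^ 2 := by
      have := norm_nonneg w
      gcongr
    rw [mul_pow, div_pow, s3, inner_E2] at h1
    rw [div_pow]
    have := norm_sq_E2 w
    have : (w 0 * u 0 + w 1 * u 1) ^ 2 + (w 0 * u 1 - w 1 * u 0) ^ 2 = ‖w‖ ^ 2 := by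
      rw [this]; linear_combination (w 0 ^ 2 + w 1 ^ 2) * hu
    linarith
  have kz := key z hz
  have ky := key y hy
  have hzn := norm_nonneg z
  have hyn := norm_nonneg y
  have hin : ‖z‖ * ‖y‖ / 2 ≤ ⟪z, y⟫ := by
    have e : ⟪z, y⟫ = ⟪z, u⟫ * ⟪y, u⟫ + (z 0 * u 1 - z 1 * u 0) * (y 0 * u 1 - y 1 * u 0) := by
      simp only [inner_E2]
      linear_combination (-(z 0 * y 0 + z 1 * y 1)) * hu
    have h1 : ‖z‖ * (√3 / 2) * (‖y‖ * (√3 / 2)) ≤ ⟪z, u⟫ * ⟪y, u⟫ := by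
      have : 0 ≤ ‖z‖ * (√3 / 2) := by positivity
      have : 0 ≤ ‖y‖ * (√3 / 2) := by positivity
      apply mul_le_mul hz hy <;> linarith
    have h2 : |(z 0 * u 1 - z 1 * u 0) * (y 0 * u 1 - y 1 * u 0)| ≤ (‖z‖ / 2) * (‖y‖ / 2) := by
      rw [abs_mul]; gcongr
    have h3 := neg_abs_le ((z 0 * u 1 - z 1 * u 0) * (y 0 * u 1 - y 1 * u 0))
    have h4 : ‖z‖ * (√3 / 2) * (‖y‖ * (√3 / 2)) = 3 / 4 * (‖z‖ * ‖y‖) := by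
      linear_combination (‖z‖ * ‖y‖ / 4) * s3
    linarith
  rw [mem_closedBall, dist_eq_norm]
  refine le_of_sq_le_sq_aux ?_ (by linarith)
  rw [norm_sub_sq_real]
  rcases le_total ‖z‖ ‖y‖ with h | h <;> nlinarith

lemma TT_mem (α r ρ : ℝ) (hr : 0 < r) (hrα : r ≤ α) (hρ : 0 < ρ) (hρr : ρ ≤ r / 2)
    (u x : E2) (h1 : 0 ≤ x 1) (hx : x 0 ^ 2 + x 1 ^ 2 ≤ r * ρ)
    (h0 : 0 ≤ ⟪x, u⟫) (h : 3 / 4 * (x 0 ^ 2 + x 1 ^ 2) ≤ ⟪x, u⟫ ^ 2) :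
    x ∈ sector u (π / 6) r ∩ closedBall ((α - ρ) • e₂) α := by
  refine ⟨⟨mem_cone_of u x h0 h, ?_⟩, ?_⟩
  · rw [mem_closedBall_zero_iff]
    refine le_of_sq_le_sq_aux ?_ hr.le
    rw [norm_sq_E2]; nlinarith
  · rw [mem_closedBall, dist_eq_norm]
    refine le_of_sq_le_sq_aux ?_ (by linarith)
    rw [norm_sq_E2]
    simp only [PiLp.sub_apply, PiLp.smul_apply, e₂, pt_zero', pt_one', smul_eq_mul]
    have : 0 ≤ x 1 * (α - ρ) := mul_nonneg h1 (by linarith)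
    nlinarith

theorem statement10
    (α r ρ : ℝ) (hα : 0 < α) (hr : 0 < r) (hrα : r ≤ α) (hρ : 0 < ρ) (hρr : ρ ≤ r / 2) :
    ∀ y ∈ Gset r, ∃ u ∈ W𝒢,
      y ∈ sector u (π / 6) r ∧ sector u (π / 6) r ⊆ closedBall y r ∧
        ENNReal.ofReal (π / 12 * r ^ ((1 : ℝ) / 2) * ρ ^ ((3 : ℝ) / 2))
          ≤ volume (sector u (π / 6) r ∩ closedBall ((α - ρ) • e₂) α) := by
  rintro y ⟨hyr, hy⟩
  have hv : ENNReal.ofReal (π / 12 * r ^ ((1 : ℝ) / 2) * ρ ^ ((3 : ℝ) / 2))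
      ≤ volume (TT (r * ρ)) := by
    refine le_trans (ENNReal.ofReal_le_ofReal ?_) (vol_TT (r * ρ) (by positivity))
    have e : ρ ^ ((3 : ℝ) / 2) = ρ * ρ ^ ((1 : ℝ) / 2) := by
      rw [show (3 : ℝ) / 2 = 1 + 1 / 2 by norm_num, Real.rpow_add hρ, Real.rpow_one]
    have e2 : r = r ^ ((1 : ℝ) / 2) * r ^ ((1 : ℝ) / 2) := by
      rw [← Real.rpow_add hr]; norm_num
    have hle : ρ ^ ((1 : ℝ) / 2) ≤ r ^ ((1 : ℝ) / 2) :=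
      Real.rpow_le_rpow hρ.le (by linarith) (by norm_num)
    have hrp : 0 ≤ r ^ ((1 : ℝ) / 2) := by positivity
    calc π / 12 * r ^ ((1 : ℝ) / 2) * ρ ^ ((3 : ℝ) / 2)
        = π / 12 * ρ * (r ^ ((1 : ℝ) / 2) * ρ ^ ((1 : ℝ) / 2)) := by rw [e]; ring
      _ ≤ π / 12 * ρ * (r ^ ((1 : ℝ) / 2) * r ^ ((1 : ℝ) / 2)) := by gcongr
      _ = π / 12 * (r * ρ) := by rw [← e2]; ring
  -- reduction to the cone condition and a volume bound
  have main : ∀ u ∈ W𝒢, u 0 ^ 2 + u 1 ^ 2 = 1 → 0 ≤ ⟪y, u⟫ →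
      3 / 4 * (y 0 ^ 2 + y 1 ^ 2) ≤ ⟪y, u⟫ ^ 2 →
      (volume (TT (r * ρ)) ≤ volume (sector u (π / 6) r ∩ closedBall ((α - ρ) • e₂) α)) →
      ∃ u ∈ W𝒢, y ∈ sector u (π / 6) r ∧ sector u (π / 6) r ⊆ closedBall y r ∧
        ENNReal.ofReal (π / 12 * r ^ ((1 : ℝ) / 2) * ρ ^ ((3 : ℝ) / 2))
          ≤ volume (sector u (π / 6) r ∩ closedBall ((α - ρ) • e₂) α) := by
    intro u hu hu1 h0 h1 hvol
    have hm : y ∈ sector u (π / 6) r := ⟨mem_cone_of u y h0 h1, hyr⟩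
    exact ⟨u, hu, hm, sector_diam u y r hu1 hm, hv.trans hvol⟩
  have hn := norm_sq_E2 y
  have hn0 := norm_nonneg y
  have hs := s3
  have hsp := s3p
  rw [inner_E2] at hy
  simp only [e₂, pt_zero', pt_one'] at hy
  rcases le_total (y 1) (‖y‖ / 2) with hq | hq
  · have hq2 : y 1 ^ 2 ≤ ‖y‖ ^ 2 / 4 := by nlinarith
    rcases le_total 0 (y 0) with hp | hp
    · refine main (pt 1 0) (by simp [W𝒢]) (by simp [pt_zero', pt_one']) ?_ ?_ ?_
      · rw [inner_E2, pt_zero', pt_one']; linarith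
      · rw [inner_E2, pt_zero', pt_one']; nlinarith
      · apply measure_mono
        rintro x ⟨h1, h2, h3⟩
        have h4 : 0 ≤ √3 * x 1 := by positivity
        apply TT_mem α r ρ hr hrα hρ hρr _ _ h1 h3 <;> rw [inner_E2, pt_zero', pt_one']
        · linarith
        · nlinarith
    · refine main (pt (-1) 0) (by simp [W𝒢]) (by simp [pt_zero', pt_one']) ?_ ?_ ?_
      · rw [inner_E2, pt_zero', pt_one']; linarith
      · rw [inner_E2, pt_zero', pt_one']; nlinarith
      · rw [← vol_refl (-1) 0 (by norm_num) _ (measTT _)]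
        apply measure_mono
        intro x hx
        simp only [mem_preimage, TT, mem_ofPred_eq, reflMap_apply, pt_zero', pt_one'] at hx
        obtain ⟨h1, h2, h3⟩ := hx
        have h1 : 0 ≤ x 1 := by linarith
        have h2 : √3 * x 1 ≤ -x 0 := by linarith
        have h4 : 0 ≤ √3 * x 1 := by positivity
        apply TT_mem α r ρ hr hrα hρ hρr _ _ h1 (by linarith) <;> rw [inner_E2, pt_zero', pt_one']
        · linarith
        · nlinarith
  · have hq0 : 0 ≤ y 1 := by linarith
    have hq2 : y 0 ^ 2 ≤ (√3 * y 1) ^ 2 := by rw [mul_pow, s3]; nlinarith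
    have hq3 : |y 0| ≤ √3 * y 1 := abs_le_of_sq_le_sq hq2 (by positivity)
    rw [abs_le] at hq3
    have hq4 : 0 ≤ √3 * y 1 := by positivity
    rcases le_total 0 (y 0) with hp | hp
    · refine main (pt (1 / 2) (√3 / 2)) (by simp [W𝒢]) (by rw [pt_zero', pt_one']; linarith) ?_ ?_ ?_
      · rw [inner_E2, pt_zero', pt_one']; linarith
      · rw [inner_E2, pt_zero', pt_one']
        have := mul_nonneg hp (sub_nonneg.2 hq3.2)
        nlinarith
      · rw [← vol_refl 0 1 (by norm_num) _ (measTT _)]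
        apply measure_mono
        intro x hx
        simp only [mem_preimage, TT, mem_ofPred_eq, reflMap_apply, pt_zero', pt_one'] at hx
        obtain ⟨h1, h2, h3⟩ := hx
        have h1 : 0 ≤ x 0 := by linarith
        have h2 : √3 * x 0 ≤ x 1 := by linarith
        have h4 : 0 ≤ √3 * x 0 := by positivity
        have h5 : 0 ≤ x 1 := by linarith
        have h6 : 0 ≤ √3 * x 1 := by positivity
        have h7 : 0 ≤ x 0 * (√3 * x 1 - x 0) := mul_nonneg h1 (by nlinarith)
        apply TT_mem α r ρ hr hrα hρ hρr _ _ h5 (by linarith) <;> rw [inner_E2, pt_zero', pt_one']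
        · linarith
        · nlinarith
    · refine main (pt (-(1 / 2)) (√3 / 2)) (by simp [W𝒢]) (by rw [pt_zero', pt_one']; linarith) ?_ ?_ ?_
      · rw [inner_E2, pt_zero', pt_one']; linarith
      · rw [inner_E2, pt_zero', pt_one']
        have := mul_nonneg (neg_nonneg.2 hp) (by linarith : 0 ≤ √3 * y 1 + y 0)
        nlinarith
      · rw [← vol_refl 0 1 (by norm_num) _ (measTT _),
          ← vol_refl (-1) 0 (by norm_num) _ ((measTT _).preimage
            (LinearMap.continuous_of_finiteDimensional _).measurable)]
        apply measure_mono
        intro x hx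
        simp only [mem_preimage, TT, mem_ofPred_eq, reflMap_apply, pt_zero', pt_one'] at hx
        obtain ⟨h1, h2, h3⟩ := hx
        have h1 : 0 ≤ -x 0 := by linarith
        have h2 : √3 * (-x 0) ≤ x 1 := by linarith
        have h4 : 0 ≤ √3 * (-x 0) := by positivity
        have h5 : 0 ≤ x 1 := by linarith
        have h6 : 0 ≤ √3 * x 1 := by positivity
        have h7 : 0 ≤ (-x 0) * (√3 * x 1 - (-x 0)) := mul_nonneg h1 (by nlinarith)
        apply TT_mem α r ρ hr hrα hρ hρr _ _ h5 (by linarith) <;> rw [inner_E2, pt_zero', pt_one']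
        · linarith
        · nlinarith
end
end

section
/- Let α > 0, let r satisfy 0 < r ≤ α, and let ρ satisfy 0 < ρ ≤ r/2. Set h₁ = ρ(2α−ρ)/(2(α+r−ρ)), h₂ = ρ(2r−ρ)/(2(α+r−ρ)), 𝒞(h₁) = {x ∈ ℝ² : −h₁ ≤ ⟨x,e₂⟩ ≤ 0} ∩ B(−r e₂, r), and 𝒜(h₂) = {z ∈ ℝ² : −(h₁+h₂) ≤ ⟨z,e₂⟩ ≤ −h₁} ∩ B((α−ρ)e₂, α). Then μ(𝒜(h₂)) ≤ μ(𝒞(h₁)); consequently μ(B(−r e₂, r) ∩ B((α−ρ)e₂, α)) ≤ 2·μ(𝒞(h₁)). -/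
open MeasureTheory Metric Set
open scoped RealInnerProductSpace ENNReal

noncomputable section

/-- `𝒞(h) = {x : −h ≤ ⟪x, e₂⟫ ≤ 0} ∩ B(−r e₂, r)`. -/
def Cset (h r : ℝ) : Set E2 :=
  {x : E2 | -h ≤ ⟪x, e₂⟫ ∧ ⟪x, e₂⟫ ≤ 0} ∩ closedBall (-(r • e₂)) r

theorem inner_e2 (x : E2) : ⟪x, e₂⟫ = x 1 := by
  simp [e₂, pt, PiLp.inner_apply, Fin.sum_univ_two]

theorem mem_ball_iff (x : E2) (c s : ℝ) (hs : 0 ≤ s) :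
    x ∈ closedBall (c • e₂) s ↔ x 0 ^ 2 + (x 1 - c) ^ 2 ≤ s ^ 2 := by
  rw [mem_closedBall, EuclideanSpace.dist_eq, Real.sqrt_le_left hs]
  simp [e₂, pt, Fin.sum_univ_two, Real.dist_eq, sq_abs]

theorem measurableSet_Cset (h r : ℝ) : MeasurableSet (Cset h r) := by
  have hc : Continuous fun x : E2 => ⟪x, e₂⟫ := by fun_prop
  exact (((isClosed_le continuous_const hc).inter
    (isClosed_le hc continuous_const)).inter isClosed_closedBall).measurableSet

theorem statement17
    (α r ρ : ℝ) (hα : 0 < α) (hr : 0 < r) (hrα : r ≤ α) (hρ : 0 < ρ) (hρr : ρ ≤ r / 2)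
    (h₁ h₂ : ℝ)
    (hh₁ : h₁ = ρ * (2 * α - ρ) / (2 * (α + r - ρ)))
    (hh₂ : h₂ = ρ * (2 * r - ρ) / (2 * (α + r - ρ)))
    (𝒜 : Set E2)
    (h𝒜 : 𝒜 = {z : E2 | -(h₁ + h₂) ≤ ⟪z, e₂⟫ ∧ ⟪z, e₂⟫ ≤ -h₁}
              ∩ closedBall ((α - ρ) • e₂) α) :
    volume 𝒜 ≤ volume (Cset h₁ r) ∧
      volume (closedBall (-(r • e₂)) r ∩ closedBall ((α - ρ) • e₂) α)
        ≤ 2 * volume (Cset h₁ r) := by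
  have hD : 0 < α + r - ρ := by linarith
  have hsum : h₁ + h₂ = ρ := by
    rw [hh₁, hh₂]; field_simp; ring
  have hdiff : (h₁ - h₂) * (α + r - ρ) = ρ * (α - r) := by
    rw [hh₁, hh₂]; field_simp; ring
  have hle : h₂ ≤ h₁ := by
    by_contra hlt
    push Not at hlt
    nlinarith [mul_pos (sub_pos.2 hlt) hD, mul_nonneg hρ.le (sub_nonneg.2 hrα)]
  have hchord : h₁ * (2 * r - h₁) = h₂ * (2 * α - h₂) := by
    have e1 : h₁ * (2 * (α + r - ρ)) = ρ * (2 * α - ρ) := by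
      rw [hh₁]; field_simp
    have e2 : h₂ = ρ - h₁ := by linarith
    rw [e2]; linarith
  have hneg : -(r • e₂) = (-r) • e₂ := by simp
  have key : volume 𝒜 ≤ volume (Cset h₁ r) := by
    have hmp := Measure.measurePreserving_sub_left (volume : Measure E2) ((-(2 * h₁)) • e₂)
    rw [← hmp.measure_preimage (measurableSet_Cset h₁ r).nullMeasurableSet]
    apply measure_mono
    intro z hz
    rw [h𝒜] at hz
    obtain ⟨⟨hz1, hz2⟩, hz3⟩ := hz
    rw [mem_ball_iff _ _ _ hα.le] at hz3
    rw [inner_e2] at hz1 hz2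
    have c0 : ((-(2 * h₁)) • e₂ - z) 0 = - z 0 := by simp [e₂, pt]
    have c1 : ((-(2 * h₁)) • e₂ - z) 1 = -(2 * h₁) - z 1 := by simp [e₂, pt]
    refine ⟨⟨?_, ?_⟩, ?_⟩
    · rw [inner_e2, c1]; linarith
    · rw [inner_e2, c1]; linarith
    · rw [hneg, mem_ball_iff _ _ _ hr.le, c0, c1]
      obtain ⟨t, ht⟩ : ∃ t, t = -h₁ - z 1 := ⟨_, rfl⟩
      have ez : z 1 = -h₁ - t := by linarith
      have ht0 : 0 ≤ t := by linarith
      have eρ : ρ = h₁ + h₂ := hsum.symm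
      rw [ez, eρ] at hz3
      rw [ez]
      nlinarith [mul_nonneg ht0 (sub_nonneg.2 hrα), mul_nonneg ht0 (sub_nonneg.2 hle)]
  refine ⟨key, ?_⟩
  have hsub : closedBall (-(r • e₂)) r ∩ closedBall ((α - ρ) • e₂) α ⊆ Cset h₁ r ∪ 𝒜 := by
    rintro z ⟨hz1, hz2⟩
    have hb1 := hz1
    have hb2 := hz2
    rw [hneg, mem_ball_iff _ _ _ hr.le] at hb1
    rw [mem_ball_iff _ _ _ hα.le] at hb2
    have u1 := abs_le_of_sq_le_sq' (by nlinarith [sq_nonneg (z 0)]) hr.le (a := z 1 - -r)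
    have u2 := abs_le_of_sq_le_sq' (by nlinarith [sq_nonneg (z 0)]) hα.le (a := z 1 - (α - ρ))
    rcases le_total (-h₁) (z 1) with h | h
    · left
      refine ⟨⟨?_, ?_⟩, hz1⟩
      · rw [inner_e2]; exact h
      · rw [inner_e2]; linarith [u1.2]
    · right
      rw [h𝒜]
      refine ⟨⟨?_, ?_⟩, hz2⟩
      · rw [inner_e2]; linarith [u2.1]
      · rw [inner_e2]; exact h
  calc _ ≤ volume (Cset h₁ r ∪ 𝒜) := measure_mono hsub
    _ ≤ volume (Cset h₁ r) + volume 𝒜 := measure_union_le _ _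
    _ ≤ volume (Cset h₁ r) + volume (Cset h₁ r) := by gcongr
    _ = _ := (two_mul _).symm
end
end
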